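/- Let ψ = e_u ⊗ (λ₊ e_v ⊗ e₁ + λ₋ e_{v̄} ⊗ e₀) ∈ (ℂ²)^{⊗n} with α even, ρ = |ψ⟩⟨ψ|, R the R-matrix of ρ, and C = 2λ₊λ₋ the concurrence of ψ. Then the multiset of eigenvalues of the 3×3 matrix RᵀR is {2^{α−2}·C², 2^{α−2}·C², 1}; explicitly, (RᵀR)₁₁ = (RᵀR)₂₂ = 2^{α−2}C² and (RᵀR)₃₃ = 1. -/

import Mathlib

open Matrix BigOperators

noncomputable section

/-- The three Pauli matrices σx, σy, σz as 2×2 complex matrices. -/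
def σp : Fin 3 → Matrix (Fin 2) (Fin 2) ℂ
  | 0 => !![0, 1; 1, 0]
  | 1 => !![0, -Complex.I; Complex.I, 0]
  | 2 => !![1, 0; 0, -1]

/-- `a · σ` for a real 3-vector `a`. -/
def dotSigma (a : Fin 3 → ℝ) : Matrix (Fin 2) (Fin 2) ℂ :=
  ∑ i : Fin 3, (a i : ℂ) • σp i

/-- `a` is a unit vector in ℝ³. -/
def IsUnitVec (a : Fin 3 → ℝ) : Prop :=
  ∑ i : Fin 3, (a i) ^ 2 = 1

/-- Kronecker product of `n` 2×2 matrices, acting on `(ℂ²)^{⊗n}`, with the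
tensor factors indexed by `Fin n` and the basis of `(ℂ²)^{⊗n}` by `Fin n → Fin 2`. -/
def kron {n : ℕ} (A : Fin n → Matrix (Fin 2) (Fin 2) ℂ) :
    Matrix (Fin n → Fin 2) (Fin n → Fin 2) ℂ :=
  fun f g => ∏ i : Fin n, A i (f i) (g i)

/-- The Bell operator `B̃_n` on `n = m+1` qubits determined by the unit vectors
`a i`, `a' i` (with `a 0 = b`, `a' 0 = b'` and the pair of settings at the last site):
`B̃_n = (b·σ)⊗(a₂·σ)⊗⋯⊗(a_{n−1}·σ)⊗((a_n+a'_n)·σ)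
      + (b'·σ)⊗(a'₂·σ)⊗⋯⊗(a'_{n−1}·σ)⊗((a_n−a'_n)·σ)`. -/
def bellOp {m : ℕ} (a a' : Fin (m + 1) → Fin 3 → ℝ) :
    Matrix (Fin (m + 1) → Fin 2) (Fin (m + 1) → Fin 2) ℂ :=
  kron (fun i => if i = Fin.last m then dotSigma (a i + a' i) else dotSigma (a i)) +
  kron (fun i => if i = Fin.last m then dotSigma (a i - a' i) else dotSigma (a' i))

/-- The set of Bell expectation values `Tr(ρ·B̃_n)` over all Bell operators
(built from unit vectors); its supremum is the maximum violation `γ(ρ)`. -/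
def bellSet {m : ℕ} (ρ : Matrix (Fin (m + 1) → Fin 2) (Fin (m + 1) → Fin 2) ℂ) : Set ℝ :=
  {x | ∃ a a' : Fin (m + 1) → Fin 3 → ℝ,
      (∀ i, IsUnitVec (a i)) ∧ (∀ i, IsUnitVec (a' i)) ∧
      x = ((ρ * bellOp a a').trace).re}

/-- The R-matrix of a density matrix on `n = m+1` qubits:
`R_{I,i} = Tr(ρ·(σ_{i₁}⊗⋯⊗σ_{i_{n−1}}⊗σ_i))`. -/
def Rmat {m : ℕ} (ρ : Matrix (Fin (m + 1) → Fin 2) (Fin (m + 1) → Fin 2) ℂ) :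
    Matrix (Fin m → Fin 3) (Fin 3) ℝ :=
  fun I i => ((ρ * kron (fun k => σp ((Fin.snoc I i : Fin (m + 1) → Fin 3) k))).trace).re

/-- Outer product `|ψ⟩⟨ψ|`. -/
def outer {ι : Type*} (ψ : ι → ℂ) : Matrix ι ι ℂ :=
  fun f g => ψ f * (starRingEnd ℂ) (ψ g)

/-- Reduced density matrix of the last qubit (partial trace of `|ψ⟩⟨ψ|`
over the first `N` qubits). -/
def rhoA {N : ℕ} (ψ : (Fin (N + 1) → Fin 2) → ℂ) : Matrix (Fin 2) (Fin 2) ℂ :=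
  fun s t => ∑ g : Fin N → Fin 2, ψ (Fin.snoc g s) * (starRingEnd ℂ) (ψ (Fin.snoc g t))

/-- Concurrence of a pure state w.r.t. the bipartition (first `N` qubits | last qubit):
`C(ψ) = √(2(1 − Tr ρ_A²))`. -/
def concurrence {N : ℕ} (ψ : (Fin (N + 1) → Fin 2) → ℂ) : ℝ :=
  Real.sqrt (2 * (1 - ((rhoA ψ * rhoA ψ).trace).re))

/-- Bit flip on `Fin 2`. -/
def flip2 (b : Fin 2) : Fin 2 := if b = 0 then 1 else 0

/-- The paper's state `|ψ⟩ = |u⟩ ⊗ (λ₊|v⟩⊗|1⟩ + λ₋|ṽ⟩⊗|0⟩)` on `n = k+m+1` qubits,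
where `u` indexes a computational basis state of the first `k` qubits, `v` a basis
state of the next `m = α−1` qubits, `ṽ` its bitwise complement, and the last qubit
carries `|1⟩`, `|0⟩` (with `e₀ = (1,0)ᵀ`, `e₁ = (0,1)ᵀ`). -/
def psiState (k m : ℕ) (u : Fin k → Fin 2) (v : Fin m → Fin 2) (lp lm : ℝ) :
    (Fin (k + m + 1) → Fin 2) → ℂ :=
  fun f =>
    (if (fun i : Fin k => f (Fin.castLE (by omega) i)) = u then 1 else 0) *
      ((lp : ℂ) * (if (fun i : Fin m => f ⟨k + i.1, by omega⟩) = v then 1 else 0) *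
          (if f (Fin.last (k + m)) = 1 then 1 else 0) +
        (lm : ℂ) *
            (if (fun i : Fin m => f ⟨k + i.1, by omega⟩) = fun i => flip2 (v i) then 1 else 0) *
          (if f (Fin.last (k + m)) = 0 then 1 else 0))

/-- Von Neumann entropy `−Tr(ρ ln ρ)` of a Hermitian matrix, via its eigenvalues. -/
def vonNeumannEntropy {d : Type*} [Fintype d] [DecidableEq d] (ρ : Matrix d d ℂ)
    (h : ρ.IsHermitian) : ℝ :=
  -∑ i, h.eigenvalues i * Real.log (h.eigenvalues i)

/-- The `k + m` leading bits of the basis vector of `psiState` whose last bit is `s`. -/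
def leadBits {k m : ℕ} (u : Fin k → Fin 2) (v : Fin m → Fin 2) (s : Fin 2) :
    Fin (k + m) → Fin 2 :=
  Fin.append u (fun i => if s = 1 then v i else flip2 (v i))

theorem psiState_eq_sum {k m : ℕ} (u : Fin k → Fin 2) (v : Fin m → Fin 2) (lp lm : ℝ)
    (f : Fin (k + m + 1) → Fin 2) :
    psiState k m u v lp lm f =
      ∑ s : Fin 2, ((![lm, lp] s : ℝ) : ℂ) *
        if f = Fin.snoc (α := fun _ => Fin 2) (leadBits u v s) s then 1 else 0 := by
  have key : ∀ (w : Fin m → Fin 2) (s : Fin 2),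
      f = Fin.snoc (α := fun _ => Fin 2) (Fin.append u w) s ↔
        (fun i : Fin k => f (Fin.castLE (by omega) i)) = u ∧
        (fun i : Fin m => f ⟨k + i.1, by omega⟩) = w ∧ f (Fin.last (k + m)) = s := by
    intro w s
    constructor
    · rintro rfl
      refine ⟨funext fun i => ?_, funext fun i => ?_, by simp⟩
      · change Fin.snoc (α := fun _ => Fin 2) (Fin.append u w) s
          (Fin.castSucc (Fin.castAdd m i)) = _
        simp
      · change Fin.snoc (α := fun _ => Fin 2) (Fin.append u w) s
          (Fin.castSucc (Fin.natAdd k i)) = _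
        rw [Fin.snoc_castSucc, Fin.append_right]
    · rintro ⟨rfl, rfl, rfl⟩
      funext j
      refine Fin.lastCases (by simp) (fun j => ?_) j
      rw [Fin.snoc_castSucc]
      refine Fin.addCases (fun i => ?_) (fun i => ?_) j
      · rw [Fin.append_left]; rfl
      · rw [Fin.append_right]; rfl
  simp only [Fin.sum_univ_two, leadBits, key, psiState]
  by_cases h1 : (fun i : Fin k => f (Fin.castLE (by omega) i)) = u <;>
  by_cases h2 : (fun i : Fin m => f ⟨k + i.1, by omega⟩) = v <;>
  by_cases h3 : (fun i : Fin m => f ⟨k + i.1, by omega⟩) = fun i => flip2 (v i) <;>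
  by_cases h4 : f (Fin.last (k + m)) = 1 <;>
  by_cases h5 : f (Fin.last (k + m)) = 0 <;>
  simp [h1, h2, h3, h4, h5, add_comm]

theorem trace_outer_mul {ι κ : Type*} [Fintype ι] [DecidableEq ι] [Fintype κ]
    (c : κ → ℝ) (F : κ → ι) (ψ : ι → ℂ)
    (hψ : ∀ f, ψ f = ∑ s, (c s : ℂ) * if f = F s then 1 else 0) (M : Matrix ι ι ℂ) :
    (outer ψ * M).trace = ∑ s, ∑ t, (c s * c t : ℂ) * M (F t) (F s) := by
  have hconj : ∀ f, (starRingEnd ℂ) (ψ f) = ψ f := by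
    intro f
    simp [hψ, apply_ite]
  have hsum : ∀ g : ι → ℂ, ∑ f, ψ f * g f = ∑ s, (c s : ℂ) * g (F s) := by
    intro g
    simp only [hψ, Finset.sum_mul]
    rw [Finset.sum_comm]
    simp
  simp only [Matrix.trace, Matrix.diag, Matrix.mul_apply, outer, hconj, mul_assoc,
    ← Finset.mul_sum, hsum]

theorem σp_conj (p : Fin 3) (a b : Fin 2) : (starRingEnd ℂ) (σp p a b) = σp p b a := by
  fin_cases p <;> fin_cases a <;> fin_cases b <;> simp [σp]

theorem kron_snoc_apply {n : ℕ} (I : Fin n → Fin 3) (i : Fin 3) (x y : Fin n → Fin 2)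
    (s t : Fin 2) :
    kron (fun k => σp ((Fin.snoc I i : Fin (n + 1) → Fin 3) k))
        (Fin.snoc (α := fun _ => Fin 2) x s) (Fin.snoc (α := fun _ => Fin 2) y t) =
      (∏ j, σp (I j) (x j) (y j)) * σp i s t := by
  simp [kron, Fin.prod_univ_castSucc]

theorem Rmat_psiState {k m : ℕ} (u : Fin k → Fin 2) (v : Fin m → Fin 2) (lp lm : ℝ)
    (I : Fin (k + m) → Fin 3) (i : Fin 3) :
    (Rmat (outer (psiState k m u v lp lm)) I i : ℂ) =
      ∑ s : Fin 2, ∑ t : Fin 2, ((![lm, lp] s : ℝ) * (![lm, lp] t : ℝ) : ℂ) *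
        ((∏ j, σp (I j) (leadBits u v t j) (leadBits u v s j)) * σp i t s) := by
  unfold Rmat
  rw [trace_outer_mul _ _ _ (psiState_eq_sum u v lp lm)]
  simp only [kron_snoc_apply]
  rw [← Complex.conj_eq_iff_re]
  simp only [map_sum, map_mul, map_prod, σp_conj, Complex.conj_ofReal]
  rw [Finset.sum_comm]
  simp only [mul_comm]

/-- The contraction `∑ₚ σₚ ⊗ σₚ` of the Pauli matrices, entrywise. -/
def pauliSwap (a b c d : Fin 2) : ℂ := ∑ p : Fin 3, σp p a b * σp p c d

theorem pauliSwap_eq (a b c d : Fin 2) :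
    pauliSwap a b c d =
      2 * (if a = d ∧ b = c then 1 else 0) - (if a = b ∧ c = d then 1 else 0) := by
  fin_cases a <;> fin_cases b <;> fin_cases c <;> fin_cases d <;>
    norm_num [pauliSwap, σp, Fin.sum_univ_three]

theorem prod_pauliSwap_leadBits {k m : ℕ} (u : Fin k → Fin 2) (v : Fin m → Fin 2)
    (s t s' t' : Fin 2) :
    ∏ j, pauliSwap (leadBits u v s j) (leadBits u v t j)
        (leadBits u v s' j) (leadBits u v t' j) = pauliSwap s t s' t' ^ m := by
  have hu : ∀ a, pauliSwap a a a a = 1 := by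
    intro a
    norm_num [pauliSwap_eq]
  have hv : ∀ a : Fin 2, pauliSwap (if s = 1 then a else flip2 a) (if t = 1 then a else flip2 a)
      (if s' = 1 then a else flip2 a) (if t' = 1 then a else flip2 a) = pauliSwap s t s' t' := by
    have hiff : ∀ a x y : Fin 2, ((if x = 1 then a else flip2 a) =
        (if y = 1 then a else flip2 a)) ↔ x = y := by decide
    intro a
    simp only [pauliSwap_eq, hiff]
  simp [Fin.prod_univ_add, leadBits, hu, hv]

theorem sum_prod_mul_prod {n : ℕ} (x y z w : Fin n → Fin 2) :
    ∑ I : Fin n → Fin 3, (∏ j, σp (I j) (x j) (y j)) * ∏ j, σp (I j) (z j) (w j) =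
      ∏ j, pauliSwap (x j) (y j) (z j) (w j) := by
  simp only [pauliSwap, Finset.prod_univ_sum, Fintype.piFinset_univ, Finset.prod_mul_distrib]

theorem RtR_psiState_apply {k m : ℕ} (u : Fin k → Fin 2) (v : Fin m → Fin 2) (lp lm : ℝ)
    (i j : Fin 3) :
    (((Rmat (outer (psiState k m u v lp lm)))ᵀ *
        Rmat (outer (psiState k m u v lp lm))) i j : ℂ) =
      ∑ s' : Fin 2, ∑ t' : Fin 2, ∑ s : Fin 2, ∑ t : Fin 2,
        ((![lm, lp] s : ℝ) * (![lm, lp] t : ℝ) * (![lm, lp] s' : ℝ) * (![lm, lp] t' : ℝ) : ℂ) *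
          (pauliSwap t s t' s' ^ m * (σp i t s * σp j t' s')) := by
  simp only [Matrix.mul_apply, Matrix.transpose_apply, Complex.ofReal_sum, Complex.ofReal_mul,
    Rmat_psiState, ← prod_pauliSwap_leadBits u v, ← sum_prod_mul_prod, Finset.sum_mul,
    Finset.mul_sum]
  rw [Finset.sum_comm]
  refine Finset.sum_congr rfl fun s' _ => ?_
  rw [Finset.sum_comm]
  refine Finset.sum_congr rfl fun t' _ => ?_
  rw [Finset.sum_comm]
  refine Finset.sum_congr rfl fun s _ => ?_
  rw [Finset.sum_comm]
  refine Finset.sum_congr rfl fun t _ => ?_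
  refine Finset.sum_congr rfl fun I _ => ?_
  ring

/-- for `ψ = e_u ⊗ (λ₊ e_v ⊗ e₁ + λ₋ e_{v̄} ⊗ e₀)` with `α = m+1` even,
`ρ = |ψ⟩⟨ψ|`, and `C = 2λ₊λ₋`, the matrix `RᵀR` equals
`diag(2^{α−2}C², 2^{α−2}C², 1)`; in particular its eigenvalue multiset is
`{2^{α−2}C², 2^{α−2}C², 1}`. -/
theorem RtR_eigenvalues_even {k m : ℕ} (hm : 1 ≤ m) (α : ℕ) (hα : α = m + 1)
    (heven : Even α)
    (u : Fin k → Fin 2) (v : Fin m → Fin 2) (lp lm : ℝ)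
    (hlp : 0 < lp) (hlm : 0 < lm) (hnorm : lp ^ 2 + lm ^ 2 = 1)
    (C : ℝ) (hC : C = 2 * lp * lm) :
    (Rmat (outer (psiState k m u v lp lm)))ᵀ * Rmat (outer (psiState k m u v lp lm)) =
      Matrix.diagonal ![(2 : ℝ) ^ (α - 2) * C ^ 2, (2 : ℝ) ^ (α - 2) * C ^ 2, 1] := by
  obtain ⟨r, rfl⟩ : ∃ r, m = 2 * r + 1 := by
    obtain ⟨q, hq⟩ := heven
    exact ⟨q - 1, by omega⟩
  subst hα hC
  have hn : (lp : ℂ) ^ 2 + (lm : ℂ) ^ 2 = 1 := by exact_mod_cast hnorm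
  have hodd : (-1 : ℂ) ^ (2 * r + 1) = -1 := Odd.neg_one_pow ⟨r, rfl⟩
  have hα : 2 * r + 1 + 1 - 2 = 2 * r := by omega
  ext i j
  apply Complex.ofReal_injective
  rw [RtR_psiState_apply, hα]
  fin_cases i <;> fin_cases j <;>
    simp [Fin.sum_univ_two, pauliSwap_eq, σp, hodd]
  on_goal 5 =>
    norm_num
    linear_combination ((lp : ℂ) ^ 2 + (lm : ℂ) ^ 2 + 1) * hn
  all_goals ring
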